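/- For x > 0 and real ν > 0 with ν not an integer, define K_ν(x) = (π / (2 sin(νπ))) (I_{-ν}(x) - I_ν(x)) where I_μ(x) = ∑_{n≥0} (x/2)^{μ+2n}/(n! Γ(μ+n+1)). Then for all real ν ≥ 1/2 and x > 0, K_ν(x) > 0. -/

import Mathlib

open Real Filter

noncomputable section

/-- Modified Bessel function of the first kind,
    I_ν(x) = ∑ₙ (x/2)^{ν+2n}/(n! Γ(ν+n+1)). -/
def besselI (ν x : ℝ) : ℝ :=
  ∑' n : ℕ, (x / 2) ^ (ν + 2 * (n : ℝ)) / ((Nat.factorial n : ℝ) * Real.Gamma (ν + n + 1))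

/-- Modified Bessel function of the second kind:
    K_ν(x) = (π/(2 sin(νπ)))(I₋ν(x) - I_ν(x)) for non-integer ν,
    extended by continuity (limit over non-integer orders) to integer ν. -/
def besselK (ν x : ℝ) : ℝ :=
  limUnder (nhdsWithin ν {μ : ℝ | ∀ n : ℤ, μ ≠ (n : ℝ)})
    (fun μ => Real.pi / (2 * Real.sin (μ * Real.pi)) * (besselI (-μ) x - besselI μ x))

section
open MeasureTheory Set Topology

/-- The integrand of the integral representation. -/
def bker (a w t : ℝ) : ℝ := t ^ a * Real.exp (-t - w / t)

/-- `∫₀^∞ t^{-μ-1} e^{-t-w/t} dt`. -/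
def bH (μ w : ℝ) : ℝ := ∫ t in Ioi (0:ℝ), bker (-μ - 1) w t

lemma bker_pos (a w : ℝ) {t : ℝ} (ht : 0 < t) : 0 < bker a w t := by
  unfold bker; positivity

lemma bker_contOn (a w : ℝ) : ContinuousOn (bker a w) (Ioi 0) := by
  unfold bker
  intro t ht
  have ht' : t ≠ 0 := ne_of_gt ht
  apply ContinuousAt.continuousWithinAt
  refine ContinuousAt.mul (Real.continuousAt_rpow_const _ _ (Or.inl ht')) ?_
  refine Real.continuous_exp.continuousAt.comp ?_
  exact (continuousAt_id.neg).sub (continuousAt_const.div continuousAt_id ht')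

lemma bker_meas (a w : ℝ) : AEStronglyMeasurable (bker a w) (volume.restrict (Ioi 0)) :=
  (bker_contOn a w).aestronglyMeasurable measurableSet_Ioi

lemma exp_neg_div_le {w t : ℝ} (hw : 0 < w) (ht : 0 < t) (N : ℕ) :
    Real.exp (-(w / t)) ≤ (N.factorial : ℝ) / w ^ N * t ^ N := by
  have h := Real.pow_div_factorial_le_exp (w / t) (by positivity) N
  rw [Real.exp_neg]
  have h2 : (N.factorial : ℝ) / w ^ N * t ^ N = ((w / t) ^ N / (N.factorial : ℝ))⁻¹ := by
    rw [div_pow]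
    field_simp
  rw [h2]
  exact inv_anti₀ (by positivity) h

lemma bker_le (a : ℝ) {w t : ℝ} (hw : 0 < w) (ht : 0 < t) (N : ℕ) :
    bker a w t ≤ (N.factorial : ℝ) / w ^ N * (Real.exp (-t) * t ^ (a + N)) := by
  unfold bker
  have h := exp_neg_div_le hw ht N
  rw [Real.rpow_add ht, Real.rpow_natCast, sub_eq_add_neg, Real.exp_add]
  calc t ^ a * (Real.exp (-t) * Real.exp (-(w / t)))
      ≤ t ^ a * (Real.exp (-t) * ((N.factorial : ℝ) / w ^ N * t ^ N)) := by gcongr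
    _ = _ := by ring

lemma bker_int (a : ℝ) {w : ℝ} (hw : 0 < w) : IntegrableOn (bker a w) (Ioi 0) := by
  obtain ⟨N, hN⟩ := exists_nat_gt (-a)
  have h := (Real.GammaIntegral_convergent (s := a + N + 1) (by linarith)).const_mul
    ((N.factorial : ℝ) / w ^ N)
  refine Integrable.mono' h (bker_meas a w) ?_
  refine (ae_restrict_iff' measurableSet_Ioi).2 (Eventually.of_forall fun t ht => ?_)
  rw [Real.norm_of_nonneg (bker_pos a w ht).le]
  have := bker_le a hw ht N
  simpa using this

lemma bH_pos (μ : ℝ) {w : ℝ} (hw : 0 < w) : 0 < bH μ w := by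
  unfold bH
  rw [setIntegral_pos_iff_support_of_nonneg_ae _ (bker_int _ hw)]
  · have : Ioi (0:ℝ) ⊆ Function.support (bker (-μ - 1) w) ∩ Ioi 0 :=
      fun t ht => ⟨(bker_pos _ w ht).ne', ht⟩
    refine lt_of_lt_of_le ?_ (measure_mono this)
    simp
  · exact (ae_restrict_iff' measurableSet_Ioi).2
      (Eventually.of_forall fun t ht => (bker_pos _ w ht).le)

lemma bH_cont (ν : ℝ) {w : ℝ} (hw : 0 < w) : ContinuousAt (fun μ => bH μ w) ν := by
  unfold bH
  refine continuousAt_of_dominated (bound := fun t => bker (-ν - 2) w t + bker (-ν) w t)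
    (Eventually.of_forall fun μ => bker_meas _ w) ?_
    ((bker_int _ hw).add (bker_int _ hw)) ?_
  · filter_upwards [Ioo_mem_nhds (show ν - 1 < ν by linarith) (show ν < ν + 1 by linarith)]
      with μ hμ
    refine (ae_restrict_iff' measurableSet_Ioi).2 (Eventually.of_forall fun t ht => ?_)
    have ht' : 0 < t := ht
    rw [Real.norm_of_nonneg (bker_pos _ w ht).le]
    rcases le_total t 1 with h1 | h1
    · have : bker (-μ - 1) w t ≤ bker (-ν - 2) w t := by
        unfold bker
        have := Real.rpow_le_rpow_of_exponent_ge ht' h1 (show -ν - 2 ≤ -μ - 1 by linarith [hμ.2])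
        gcongr
      linarith [bker_pos (-ν) w ht']
    · have : bker (-μ - 1) w t ≤ bker (-ν) w t := by
        unfold bker
        have := Real.rpow_le_rpow_of_exponent_le h1 (show -μ - 1 ≤ -ν by linarith [hμ.1])
        gcongr
      linarith [bker_pos (-ν - 2) w ht']
  · refine (ae_restrict_iff' measurableSet_Ioi).2 (Eventually.of_forall fun t ht => ?_)
    have ht' : 0 < t := ht
    unfold bker
    refine ContinuousAt.mul ?_ continuousAt_const
    refine ContinuousAt.comp (f := fun μ : ℝ => -μ - 1) (g := fun y : ℝ => t ^ y) ?_ (by fun_prop)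
    exact Real.continuousAt_const_rpow ht'.ne'

lemma bH_deriv (μ : ℝ) {w : ℝ} (hw : 0 < w) :
    HasDerivAt (fun w => bH μ w) (-bH (μ + 1) w) w := by
  unfold bH
  have key := hasDerivAt_integral_of_dominated_loc_of_deriv_le
    (μ := volume.restrict (Ioi (0:ℝ))) (F := fun w t => bker (-μ - 1) w t)
    (F' := fun w t => -bker (-(μ + 1) - 1) w t) (x₀ := w) (s := Ioi (w / 2))
    (bound := fun t => bker (-(μ + 1) - 1) (w / 2) t)
    (Ioi_mem_nhds (by linarith)) (Eventually.of_forall fun w => bker_meas _ w)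
    (bker_int _ hw) (bker_meas _ w).neg ?_ (bker_int _ (by linarith)) ?_
  · have := key.2
    rwa [integral_neg] at this
  · refine (ae_restrict_iff' measurableSet_Ioi).2 (Eventually.of_forall fun t ht v hv => ?_)
    have ht' : 0 < t := ht
    rw [norm_neg, Real.norm_of_nonneg (bker_pos _ _ ht).le]
    unfold bker
    have hv' : w / 2 ≤ v := le_of_lt hv
    gcongr
  · refine (ae_restrict_iff' measurableSet_Ioi).2 (Eventually.of_forall fun t ht v hv => ?_)
    have ht' : 0 < t := ht
    unfold bker
    have h1 : HasDerivAt (fun v : ℝ => -t - v / t) (-(1 / t)) v := by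
      simpa using ((hasDerivAt_id v).div_const t).const_sub (-t)
    have h2 := (h1.exp).const_mul (t ^ (-μ - 1))
    refine h2.congr_deriv ?_
    rw [show -(μ + 1) - 1 = (-μ - 1) - 1 by ring, Real.rpow_sub_one ht'.ne' (-μ - 1)]
    ring

lemma bH_rec {μ w : ℝ} (hμ : μ ≠ 0) (hw : 0 < w) :
    w * bH (μ + 1) w = μ * bH μ w + bH (μ - 1) w := by
  have i1 := bker_int (-(μ + 1) - 1) hw
  have i2 := bker_int (-μ - 1) hw
  have i3 := bker_int (-(μ - 1) - 1) hw
  have key := integral_Ioi_of_hasDerivAt_of_tendsto (f := bker (-μ) w) (a := 0) (m := 0)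
    (f' := fun t => w * bker (-(μ + 1) - 1) w t - μ * bker (-μ - 1) w t - bker (-(μ - 1) - 1) w t)
    ?_ ?_ (((i1.const_mul w).sub (i2.const_mul μ)).sub i3) ?_
  · have i4 : IntegrableOn (fun t => w * bker (-(μ + 1) - 1) w t - μ * bker (-μ - 1) w t)
        (Ioi 0) := (i1.const_mul w).sub (i2.const_mul μ)
    rw [integral_sub i4 i3,
      integral_sub (i1.const_mul w) (i2.const_mul μ), integral_const_mul, integral_const_mul] at key
    have h0 : bker (-μ) w 0 = 0 := by
      unfold bker; rw [Real.zero_rpow (neg_ne_zero.2 hμ), zero_mul]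
    rw [h0] at key
    unfold bH
    linarith
  · obtain ⟨N, hN⟩ := exists_nat_gt μ
    have h0 : bker (-μ) w 0 = 0 := by
      unfold bker; rw [Real.zero_rpow (neg_ne_zero.2 hμ), zero_mul]
    have hp : 0 < -μ + N := by linarith
    unfold ContinuousWithinAt
    rw [h0]
    have hc : Tendsto (fun t : ℝ => (N.factorial : ℝ) / w ^ N * (Real.exp (-t) * t ^ (-μ + N)))
        (𝓝[Ici 0] 0) (𝓝 0) := by
      have : ContinuousAt
          (fun t : ℝ => (N.factorial : ℝ) / w ^ N * (Real.exp (-t) * t ^ (-μ + N))) 0 := by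
        refine continuousAt_const.mul (ContinuousAt.mul (by fun_prop) ?_)
        exact Real.continuousAt_rpow_const _ _ (Or.inr hp.le)
      have h := this.tendsto.mono_left (nhdsWithin_le_nhds (s := Ici 0))
      simpa [Real.zero_rpow hp.ne'] using h
    refine tendsto_of_tendsto_of_tendsto_of_le_of_le' tendsto_const_nhds hc ?_ ?_
    · filter_upwards [self_mem_nhdsWithin] with t ht
      unfold bker
      have : (0:ℝ) ≤ t := ht
      positivity
    · filter_upwards [self_mem_nhdsWithin] with t ht
      rcases eq_or_lt_of_le (show (0:ℝ) ≤ t from ht) with h | h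
      · rw [← h, h0, Real.zero_rpow hp.ne']; simp
      · exact bker_le _ hw h N
  · intro t ht
    have ht' : 0 < t := ht
    unfold bker
    have h1 : HasDerivAt (fun t : ℝ => -t - w / t) (-1 + w / t ^ 2) t := by
      have := (hasDerivAt_neg t).sub ((hasDerivAt_const t w).div (hasDerivAt_id t) ht'.ne')
      refine this.congr_deriv ?_
      simp; ring
    have h2 := (Real.hasDerivAt_rpow_const (p := -μ) (Or.inl ht'.ne')).mul h1.exp
    refine h2.congr_deriv ?_
    rw [show -(μ + 1) - 1 = (-μ - 1) - 1 by ring, Real.rpow_sub_one ht'.ne' (-μ - 1),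
      Real.rpow_sub_one ht'.ne' (-μ), show -(μ - 1) - 1 = -μ by ring]
    field_simp
    ring
  · have h := tendsto_rpow_mul_exp_neg_mul_atTop_nhds_zero (-μ) 1 one_pos
    refine tendsto_of_tendsto_of_tendsto_of_le_of_le' tendsto_const_nhds h ?_ ?_
    · filter_upwards [eventually_gt_atTop 0] with t ht using (bker_pos _ _ ht).le
    · filter_upwards [eventually_gt_atTop 0] with t ht
      unfold bker
      have : 0 ≤ w / t := by positivity
      gcongr
      linarith

lemma bH_lim {μ : ℝ} (hμ : μ < 0) : Tendsto (fun w => bH μ w) (𝓝[>] 0) (𝓝 (Real.Gamma (-μ))) := by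
  unfold bH
  rw [Real.Gamma_eq_integral (neg_pos.2 hμ)]
  refine tendsto_integral_filter_of_dominated_convergence
    (fun t => Real.exp (-t) * t ^ (-μ - 1)) (Eventually.of_forall fun w => bker_meas _ w) ?_
    (Real.GammaIntegral_convergent (neg_pos.2 hμ)) ?_
  · filter_upwards [self_mem_nhdsWithin] with w hw
    refine (ae_restrict_iff' measurableSet_Ioi).2 (Eventually.of_forall fun t ht => ?_)
    have ht' : 0 < t := ht
    have hw' : 0 < w := hw
    rw [Real.norm_of_nonneg (bker_pos _ w ht).le]
    unfold bker
    rw [mul_comm]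
    have : 0 ≤ w / t := by positivity
    gcongr
    linarith
  · refine (ae_restrict_iff' measurableSet_Ioi).2 (Eventually.of_forall fun t ht => ?_)
    have : Continuous (fun w : ℝ => bker (-μ - 1) w t) := by unfold bker; fun_prop
    have h := (this.tendsto 0).mono_left (nhdsWithin_le_nhds (s := Ioi 0))
    convert h using 2
    unfold bker
    simp [mul_comm]

lemma bH_symm (μ : ℝ) {w : ℝ} (hw : 0 < w) : w ^ μ * bH μ w = bH (-μ) w := by
  unfold bH
  have h1 := integral_comp_rpow_Ioi (bker (-μ - 1) w) (p := -1) (by norm_num)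
  have h2 := integral_comp_mul_left_Ioi
    (fun x : ℝ => (|(-1:ℝ)| * x ^ ((-1:ℝ) - 1)) • bker (-μ - 1) w (x ^ (-1:ℝ))) 0 (b := w⁻¹)
      (by positivity)
  rw [mul_zero, h1, inv_inv] at h2
  have h3 : bker (-μ - 1) w = bker (-μ - 1) w := rfl
  rw [← mul_right_inj' hw.ne', ← mul_assoc, mul_comm w, mul_assoc]
  rw [smul_eq_mul] at h2
  rw [← h2, ← integral_const_mul, ← integral_const_mul]
  refine setIntegral_congr_fun measurableSet_Ioi fun t ht => ?_
  have ht' : 0 < t := ht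
  simp only [bker, smul_eq_mul]
  rw [Real.rpow_neg_one, Real.mul_rpow (by positivity) ht'.le, mul_inv, inv_inv,
    Real.mul_rpow hw.le (by positivity), Real.inv_rpow hw.le, Real.inv_rpow ht'.le,
    ← Real.rpow_neg hw.le, ← Real.rpow_neg ht'.le]
  rw [show -(w * t⁻¹) - w / (w * t⁻¹) = -t - w / t by field_simp; ring]
  have e1 : w ^ μ * (w ^ (-(-1 - 1) : ℝ) * w ^ (-μ - 1)) = w := by
    rw [← Real.rpow_add hw, ← Real.rpow_add hw]
    rw [show μ + (-(-1 - 1) + (-μ - 1)) = 1 by ring, Real.rpow_one]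
  have e2 : t ^ (-1 - 1 : ℝ) * t ^ (-(-μ - 1)) = t ^ (- -μ - 1) := by
    rw [← Real.rpow_add ht']; congr 1; ring
  rw [← e2]
  simp only [abs_neg, abs_one]
  linear_combination t ^ (-1 - 1 : ℝ) * t ^ (-(-μ - 1)) * Real.exp (-t - w / t) * e1

lemma inv_Gamma_rec (s : ℝ) : (Real.Gamma s)⁻¹ = s * (Real.Gamma (s + 1))⁻¹ := by
  rcases eq_or_ne s 0 with rfl | h
  · simp [Real.Gamma_zero]
  · rw [Real.Gamma_add_one h, mul_inv, ← mul_assoc, mul_inv_cancel₀ h, one_mul]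

lemma inv_Gamma_bdd (a : ℝ) : ∃ C : ℝ, 0 ≤ C ∧ ∀ n : ℕ, |(Real.Gamma (a + n + 1))⁻¹| ≤ C := by
  obtain ⟨N, hN⟩ := exists_nat_gt (1 - a)
  refine ⟨1 + ∑ n ∈ Finset.range N, |(Real.Gamma (a + n + 1))⁻¹|, by positivity, fun n => ?_⟩
  rcases lt_or_ge n N with h | h
  · have := Finset.single_le_sum (f := fun n : ℕ => |(Real.Gamma (a + n + 1))⁻¹|)
      (fun i _ => abs_nonneg _) (Finset.mem_range.2 h)
    linarith
  · have hn : (N : ℝ) ≤ n := by exact_mod_cast h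
    have h2 : (2:ℝ) ≤ a + n + 1 := by linarith
    have h3 := Real.Gamma_strictMonoOn_Ici.monotoneOn (show (2:ℝ) ∈ Ici 2 from le_refl (2:ℝ))
      (show a + n + 1 ∈ Ici (2:ℝ) from h2) h2
    rw [Real.Gamma_two] at h3
    rw [abs_of_nonneg (by positivity)]
    have h4 : (Real.Gamma (a + n + 1))⁻¹ ≤ 1 := inv_le_one_of_one_le₀ h3
    have : 0 ≤ ∑ n ∈ Finset.range N, |(Real.Gamma (a + n + 1))⁻¹| := by positivity
    linarith

/-- coefficients -/
def bco (a : ℝ) (n : ℕ) : ℝ := (Real.Gamma (a + n + 1))⁻¹ / (n.factorial : ℝ)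

/-- `∑ wⁿ/(n! Γ(a+n+1))`. -/
def bphi (a w : ℝ) : ℝ := ∑' n : ℕ, bco a n * w ^ n

lemma bco_succ (a : ℝ) (n : ℕ) : bco a (n + 1) * ((n + 1 : ℕ) : ℝ) = bco (a + 1) n := by
  unfold bco
  rw [Nat.factorial_succ]
  have : a + 1 + (n:ℝ) + 1 = a + ((n + 1 : ℕ) : ℝ) + 1 := by push_cast; ring
  rw [this]
  push_cast
  have : (n.factorial : ℝ) ≠ 0 := by positivity
  have : (n : ℝ) + 1 ≠ 0 := by positivity
  field_simp

lemma bphi_summable (a w : ℝ) : Summable fun n : ℕ => bco a n * w ^ n := by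
  obtain ⟨C, hC, h⟩ := inv_Gamma_bdd a
  refine Summable.of_norm_bounded ((Real.summable_pow_div_factorial |w|).mul_left C) fun n => ?_
  unfold bco
  rw [Real.norm_eq_abs, abs_mul, abs_div, abs_pow, Nat.abs_cast]
  have := h n
  calc _ ≤ C / (n.factorial : ℝ) * |w| ^ n := by gcongr
    _ = _ := by ring

lemma bphi_deriv (a w : ℝ) : HasDerivAt (bphi a) (bphi (a + 1) w) w := by
  set R := |w| + 1 with hR
  have hR0 : 0 < R := by positivity
  obtain ⟨C, hC, h⟩ := inv_Gamma_bdd (a + 1)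
  have hs : ∀ v : ℝ, Summable fun n : ℕ => bco a n * (n * v ^ (n - 1)) := by
    intro v
    rw [← summable_nat_add_iff 1]
    refine (bphi_summable (a + 1) v).congr fun n => ?_
    rw [← bco_succ]; simp [mul_assoc]
  have hsu : Summable fun n : ℕ => |bco a n| * (n * R ^ (n - 1)) := by
    have := (hs R).abs
    refine this.congr fun n => ?_
    rw [abs_mul, abs_of_nonneg (show 0 ≤ (n:ℝ) * R ^ (n - 1) by positivity)]
  have key := hasDerivAt_tsum_of_isPreconnected (g := fun n v => bco a n * v ^ n)
    (g' := fun n v => bco a n * (n * v ^ (n - 1))) (t := Metric.ball (0:ℝ) R) (y₀ := w) (y := w)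
    hsu Metric.isOpen_ball (convex_ball _ _).isPreconnected
    (fun n y _ => (hasDerivAt_pow n y).const_mul _) ?_ (by simp [hR]) (bphi_summable a w)
    (by simp [hR])
  · have e : ∑' n : ℕ, bco a n * (n * w ^ (n - 1)) = bphi (a + 1) w := by
      rw [(hs w).tsum_eq_zero_add]
      unfold bphi
      simp only [Nat.cast_zero, zero_mul, mul_zero, zero_add]
      refine tsum_congr fun n => ?_
      rw [← bco_succ]; simp [mul_assoc]
    rw [e] at key
    exact key
  · intro n y hy
    have hy' : |y| ≤ R := by simpa using (le_of_lt hy : dist y 0 ≤ R)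
    rw [norm_mul, norm_mul, norm_pow, Real.norm_natCast, Real.norm_eq_abs, Real.norm_eq_abs]
    gcongr

lemma bphi_rec (a w : ℝ) : bphi (a - 1) w = a * bphi a w + w * bphi (a + 1) w := by
  have hs := bphi_summable a w
  have h1 := bphi_summable (a + 1) w
  have e : ∀ n : ℕ, bco (a - 1) n = a * bco a n + n * bco a n := by
    intro n
    unfold bco
    rw [inv_Gamma_rec (a - 1 + n + 1), show a - 1 + (n:ℝ) + 1 + 1 = a + n + 1 by ring]
    ring
  have h2 : Summable fun n : ℕ => n * bco a n * w ^ n := by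
    refine ((bphi_summable (a - 1) w).sub (hs.mul_left a)).congr fun n => ?_
    rw [e]; ring
  have h3 : w * bphi (a + 1) w = ∑' n : ℕ, n * bco a n * w ^ n := by
    rw [h2.tsum_eq_zero_add]
    unfold bphi
    rw [← tsum_mul_left]
    simp only [Nat.cast_zero, zero_mul, zero_add]
    refine tsum_congr fun n => ?_
    rw [← bco_succ]; ring
  rw [h3]
  unfold bphi
  rw [← tsum_mul_left, ← (hs.mul_left a).tsum_add h2]
  refine tsum_congr fun n => ?_
  rw [e]; ring

lemma bphi_zero (a : ℝ) : bphi a 0 = (Real.Gamma (a + 1))⁻¹ := by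
  unfold bphi
  rw [tsum_eq_single 0 (by intro n hn; simp [hn])]
  simp [bco]

lemma besselI_eq (ν : ℝ) {x : ℝ} (hx : 0 < x) :
    besselI ν x = (x / 2) ^ ν * bphi ν ((x / 2) ^ 2) := by
  unfold besselI bphi
  rw [← tsum_mul_left]
  refine tsum_congr fun n => ?_
  rw [Real.rpow_add (by positivity), show (2 * (n:ℝ)) = ((2 * n : ℕ) : ℝ) by push_cast; ring,
    Real.rpow_natCast, pow_mul, bco, div_eq_mul_inv, mul_inv]
  ring

/-- series candidate -/
def bS (μ w : ℝ) : ℝ := π / Real.sin (μ * π) * (w ^ (-μ) * bphi (-μ) w - bphi μ w)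

lemma sin_add_one_pi (μ : ℝ) : Real.sin ((μ + 1) * π) = - Real.sin (μ * π) := by
  rw [add_mul, one_mul, Real.sin_add_pi]

lemma bS_deriv (μ : ℝ) {w : ℝ} (hw : 0 < w) :
    HasDerivAt (fun w => bS μ w) (-bS (μ + 1) w) w := by
  unfold bS
  have h1 := (Real.hasDerivAt_rpow_const (p := -μ) (Or.inl hw.ne')).mul (bphi_deriv (-μ) w)
  have h2 := (h1.sub (bphi_deriv μ w)).const_mul (π / Real.sin (μ * π))
  refine h2.congr_deriv ?_
  have h3 := bphi_rec (-μ) w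
  rw [sin_add_one_pi, show -(μ + 1) = -μ - 1 by ring, h3, Real.rpow_sub_one hw.ne', div_neg]
  field_simp

lemma bS_rec (μ : ℝ) {w : ℝ} (hw : 0 < w) :
    w * bS (μ + 1) w = μ * bS μ w + bS (μ - 1) w := by
  unfold bS
  have h1 := bphi_rec (-μ) w
  have h2 := bphi_rec μ w
  have h3 : Real.sin ((μ - 1) * π) = - Real.sin (μ * π) := by
    rw [sub_mul, one_mul, Real.sin_sub_pi]
  rw [sin_add_one_pi, h3, show -(μ + 1) = -μ - 1 by ring, show -(μ - 1) = -μ + 1 by ring, h1, h2,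
    Real.rpow_sub_one hw.ne', Real.rpow_add_one hw.ne', div_neg]
  field_simp
  ring

lemma bS_symm (μ : ℝ) {w : ℝ} (hw : 0 < w) : w ^ μ * bS μ w = bS (-μ) w := by
  unfold bS
  rw [neg_mul, Real.sin_neg, neg_neg, Real.rpow_neg hw.le, div_neg]
  have : w ^ μ ≠ 0 := (Real.rpow_pos_of_pos hw _).ne'
  field_simp
  ring

lemma bS_lim {μ : ℝ} (h1 : -1 < μ) (hμ : μ < 0) :
    Tendsto (fun w => bS μ w) (𝓝[>] 0) (𝓝 (Real.Gamma (-μ))) := by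
  have hp : 0 < -μ := neg_pos.2 hμ
  have hc : ContinuousAt (fun w => bS μ w) 0 := by
    unfold bS
    refine continuousAt_const.mul (ContinuousAt.sub (ContinuousAt.mul ?_ ?_) ?_)
    · exact Real.continuousAt_rpow_const _ _ (Or.inr hp.le)
    · exact (bphi_deriv (-μ) 0).continuousAt
    · exact (bphi_deriv μ 0).continuousAt
  have h := hc.tendsto.mono_left (nhdsWithin_le_nhds (s := Ioi 0))
  have e : bS μ 0 = Real.Gamma (-μ) := by
    unfold bS
    have h2 := Real.Gamma_mul_Gamma_one_sub (-μ)
    have h3 : Real.Gamma (μ + 1) ≠ 0 := (Real.Gamma_pos_of_pos (by linarith)).ne'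
    rw [show 1 - -μ = μ + 1 by ring, show π * -μ = -(μ * π) by ring, Real.sin_neg, div_neg] at h2
    rw [Real.zero_rpow hp.ne', bphi_zero μ, zero_mul, zero_sub, mul_neg, ← neg_mul, ← h2,
      mul_assoc, mul_inv_cancel₀ h3, mul_one]
  rwa [e] at h

/-- difference -/
def bD (μ w : ℝ) : ℝ := bH μ w - bS μ w

lemma bD_deriv (μ : ℝ) {w : ℝ} (hw : 0 < w) :
    HasDerivAt (fun w => bD μ w) (-bD (μ + 1) w) w := by
  have := (bH_deriv μ hw).sub (bS_deriv μ hw)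
  refine this.congr_deriv ?_
  unfold bD; ring

lemma bD_rec {μ w : ℝ} (hμ : μ ≠ 0) (hw : 0 < w) :
    w * bD (μ + 1) w = μ * bD μ w + bD (μ - 1) w := by
  have h1 := bH_rec hμ hw
  have h2 := bS_rec μ hw
  unfold bD; linear_combination h1 - h2

lemma bD_symm (μ : ℝ) {w : ℝ} (hw : 0 < w) : w ^ μ * bD μ w = bD (-μ) w := by
  have h1 := bH_symm μ hw
  have h2 := bS_symm μ hw
  unfold bD; linear_combination h1 - h2

lemma bD_lim {μ : ℝ} (h1 : -1 < μ) (hμ : μ < 0) :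
    Tendsto (fun w => bD μ w) (𝓝[>] 0) (𝓝 0) := by
  have := (bH_lim hμ).sub (bS_lim h1 hμ)
  simpa [bD] using this

lemma bD_zero {μ : ℝ} (h1 : -1 < μ) (hμ : μ < 0) {w : ℝ} (hw : 0 < w) : bD μ w = 0 := by
  have hm : 0 < -μ := neg_pos.2 hμ
  have hp : 0 < μ + 1 := by linarith
  have hd : ∀ v : ℝ, 0 < v → HasDerivAt (fun v => bD μ v) (-(v ^ (-μ - 1) * bD (-(μ + 1)) v)) v := by
    intro v hv
    refine (bD_deriv μ hv).congr_deriv ?_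
    rw [← bD_symm (μ + 1) hv, ← mul_assoc, ← Real.rpow_add hv,
      show -μ - 1 + (μ + 1) = 0 by ring, Real.rpow_zero, one_mul]
  have hd2 : ∀ v : ℝ, 0 < v → HasDerivAt (fun v => bD (-(μ + 1)) v) (-(v ^ μ * bD μ v)) v := by
    intro v hv
    refine (bD_deriv _ hv).congr_deriv ?_
    rw [show -(μ + 1) + 1 = -μ by ring, bD_symm _ hv]
  set K : ℝ → ℝ := fun v => v ^ (-μ) / (-μ) + v ^ (μ + 1) / (μ + 1) with hK
  have hKd : ∀ v : ℝ, 0 < v → HasDerivAt K (v ^ (-μ - 1) + v ^ μ) v := by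
    intro v hv
    have a1 := (Real.hasDerivAt_rpow_const (x := v) (p := -μ) (Or.inl hv.ne')).div_const (-μ)
    have a2 := (Real.hasDerivAt_rpow_const (x := v) (p := μ + 1) (Or.inl hv.ne')).div_const (μ + 1)
    refine (a1.add a2).congr_deriv ?_
    rw [show μ + 1 - 1 = μ by ring, mul_div_cancel_left₀ _ hm.ne', mul_div_cancel_left₀ _ hp.ne']
  have hKc : Tendsto K (𝓝[>] 0) (𝓝 (K 0)) := by
    have : ContinuousAt K 0 := by
      refine ContinuousAt.add (ContinuousAt.div_const ?_ _) (ContinuousAt.div_const ?_ _)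
      · exact Real.continuousAt_rpow_const _ _ (Or.inr hm.le)
      · exact Real.continuousAt_rpow_const _ _ (Or.inr hp.le)
    exact this.tendsto.mono_left nhdsWithin_le_nhds
  set E : ℝ → ℝ := fun v => (bD μ v ^ 2 + bD (-(μ + 1)) v ^ 2) * Real.exp (-K v) with hE
  have hEd : ∀ v : ℝ, 0 < v → HasDerivAt E
      (-((v ^ (-μ - 1) + v ^ μ) * (bD μ v + bD (-(μ + 1)) v) ^ 2 * Real.exp (-K v))) v := by
    intro v hv
    have := (((hd v hv).pow 2).add ((hd2 v hv).pow 2)).mul (hKd v hv).neg.exp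
    refine this.congr_deriv ?_
    simp
    ring
  have hanti : AntitoneOn E (Ioi 0) := by
    refine antitoneOn_of_deriv_nonpos (convex_Ioi 0)
      (fun v hv => (hEd v hv).continuousAt.continuousWithinAt) ?_ ?_
    · rw [interior_Ioi]
      exact fun v hv => (hEd v hv).differentiableAt.differentiableWithinAt
    · rw [interior_Ioi]
      intro v hv
      have hv' : 0 < v := hv
      rw [(hEd v hv).deriv]
      have : 0 ≤ (v ^ (-μ - 1) + v ^ μ) * (bD μ v + bD (-(μ + 1)) v) ^ 2 * Real.exp (-K v) := by
        positivity
      linarith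
  have hlim : Tendsto E (𝓝[>] 0) (𝓝 0) := by
    have b1 := (bD_lim h1 hμ).pow 2
    have b2 := (bD_lim (μ := -(μ + 1)) (by linarith) (by linarith)).pow 2
    have b3 := (b1.add b2).mul ((Real.continuous_exp.tendsto _).comp hKc.neg)
    have e0 : ((0:ℝ) ^ 2 + 0 ^ 2) * Real.exp (-K 0) = 0 := by ring
    rw [e0] at b3
    exact b3
  have hle : E w ≤ 0 := by
    refine ge_of_tendsto hlim ?_
    filter_upwards [Ioo_mem_nhdsGT hw] with v hv
    exact hanti hv.1 hw hv.2.le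
  have hsq : bD μ w ^ 2 + bD (-(μ + 1)) w ^ 2 ≤ 0 := by
    by_contra hcon
    push Not at hcon
    have : 0 < E w := mul_pos hcon (Real.exp_pos _)
    linarith
  nlinarith [sq_nonneg (bD μ w), sq_nonneg (bD (-(μ + 1)) w)]

lemma bD_zero_add {μ : ℝ} (h1 : -1 < μ) (hμ : μ < 0) (n : ℕ) :
    ∀ w : ℝ, 0 < w → bD (μ + n) w = 0 := by
  induction n with
  | zero => intro w hw; simpa using bD_zero h1 hμ hw
  | succ n ih =>
    intro w hw
    have h2 := bD_deriv (μ + n) hw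
    have h3 : HasDerivAt (fun w => bD (μ + n) w) 0 w := by
      refine (hasDerivAt_const w (0:ℝ)).congr_of_eventuallyEq ?_
      filter_upwards [Ioi_mem_nhds hw] with v hv using ih v hv
    have h4 := h2.unique h3
    rw [show μ + ((n + 1 : ℕ) : ℝ) = μ + n + 1 by push_cast; ring]
    linarith

lemma bH_eq_bS {μ : ℝ} (hμ : 0 < μ) (hn : ∀ n : ℤ, μ ≠ n) {w : ℝ} (hw : 0 < w) :
    bH μ w = bS μ w := by
  have hlt : (⌊μ⌋₊ : ℝ) < μ := lt_of_le_of_ne (Nat.floor_le hμ.le)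
    (fun h => hn ⌊μ⌋₊ (by rw [← h]; simp))
  have hlt2 := Nat.lt_floor_add_one μ
  have := bD_zero_add (μ := μ - (⌊μ⌋₊ + 1 : ℕ)) (by push_cast; linarith) (by push_cast; linarith)
    (⌊μ⌋₊ + 1) w hw
  rw [sub_add_cancel] at this
  unfold bD at this
  linarith

lemma besselK_eq (ν : ℝ) (hν : 1/2 ≤ ν) (x : ℝ) (hx : 0 < x) :
    besselK ν x = (x / 2) ^ ν / 2 * bH ν ((x / 2) ^ 2) := by
  have hw : 0 < (x / 2) ^ 2 := by positivity
  have hz : 0 < x / 2 := by positivity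
  unfold besselK
  have hne : (nhdsWithin ν {μ : ℝ | ∀ n : ℤ, μ ≠ (n : ℝ)}).NeBot := by
    have hd : Dense (range (fun n : ℤ => (n : ℝ)))ᶜ := (countable_range _).dense_compl ℝ
    have he : {μ : ℝ | ∀ n : ℤ, μ ≠ (n : ℝ)} = (range (fun n : ℤ => (n : ℝ)))ᶜ := by
      ext μ; simp [eq_comm]
    rw [he]
    exact mem_closure_iff_nhdsWithin_neBot.1 (hd ν)
  apply Tendsto.limUnder_eq
  have hc : ContinuousAt (fun μ => (x / 2) ^ μ / 2 * bH μ ((x / 2) ^ 2)) ν :=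
    ((Real.continuousAt_const_rpow hz.ne').div_const 2).mul (bH_cont ν hw)
  refine (hc.tendsto.mono_left nhdsWithin_le_nhds).congr' ?_
  filter_upwards [self_mem_nhdsWithin,
    mem_nhdsWithin_of_mem_nhds (Ioi_mem_nhds (show (0:ℝ) < ν by linarith))] with μ hn hμ
  rw [bH_eq_bS hμ hn hw, besselI_eq _ hx, besselI_eq _ hx, bS]
  have e : (x / 2) ^ μ * ((x / 2) ^ 2) ^ (-μ) = (x / 2) ^ (-μ) := by
    rw [← Real.rpow_natCast, ← Real.rpow_mul hz.le, ← Real.rpow_add hz]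
    congr 1; push_cast; ring
  rw [← e, show π / (2 * Real.sin (μ * π)) = π / Real.sin (μ * π) / 2 by rw [div_div, mul_comm]]
  ring

end

theorem stmt8 (ν : ℝ) (hν : 1/2 ≤ ν) (x : ℝ) (hx : 0 < x) : 0 < besselK ν x := by
  rw [besselK_eq ν hν x hx]
  have h := bH_pos ν (show 0 < (x / 2) ^ 2 by positivity)
  positivity
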